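/- Let P be a twice continuously differentiable ℝ³-valued field on ℝ³×[0,T] satisfying the wave equation ∂ₜ²P = v_g²ΔP (componentwise) and the Dirichlet support condition, and let N_e be a continuously differentiable real-valued field on ℝ³×[0,T] such that ∇N_e(x,t) = ∇(∇·P)(x,t) for all (x,t) (i.e. ∇·P = −(N − N_e) for a scalar field N with vanishing spatial gradient). Then ‖∂ₜP(·,T)‖²_{L²(Ω)} + v_g²‖∇×P(·,T)‖²_{L²(Ω)} = ‖∂ₜP(·,0)‖²_{L²(Ω)} + v_g²‖∇×P(·,0)‖²_{L²(Ω)} + 2v_g²∫₀ᵀ∫_Ω ∂ₜP(x,t)·∇N_e(x,t) dx dt. -/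

import Mathlib

open MeasureTheory
open scoped RealInnerProductSpace

noncomputable section

/-- `V3` is Euclidean three-dimensional space. -/
abbrev V3 : Type := EuclideanSpace ℝ (Fin 3)

/-- spatial partial derivative in direction `i` of a scalar field -/
def pd (i : Fin 3) (g : V3 → ℝ) (x : V3) : ℝ :=
  fderiv ℝ g x (EuclideanSpace.single i 1)

/-- spatial divergence of a vector field -/
def sdiv (F : V3 → V3) (x : V3) : ℝ := ∑ i, pd i (fun y => F y i) x

/-- build a vector in `V3` from three coordinates -/
def vec3 (a b c : ℝ) : V3 := (WithLp.equiv 2 (Fin 3 → ℝ)).symm ![a, b, c]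

/-- spatial curl of a vector field -/
def scurl (F : V3 → V3) (x : V3) : V3 :=
  vec3 (pd 1 (fun y => F y 2) x - pd 2 (fun y => F y 1) x)
       (pd 2 (fun y => F y 0) x - pd 0 (fun y => F y 2) x)
       (pd 0 (fun y => F y 1) x - pd 1 (fun y => F y 0) x)

/-- spatial gradient of a scalar field -/
def sgrad (g : V3 → ℝ) (x : V3) : V3 :=
  (WithLp.equiv 2 (Fin 3 → ℝ)).symm (fun i => pd i g x)

/-- spatial Laplacian of a scalar field -/
def slap (g : V3 → ℝ) (x : V3) : ℝ := ∑ i, pd i (fun y => pd i g y) x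

/-- componentwise spatial Laplacian of a vector field -/
def veclap (F : V3 → V3) (x : V3) : V3 :=
  (WithLp.equiv 2 (Fin 3 → ℝ)).symm (fun i => slap (fun y => F y i) x)

/-- cross product on `V3` -/
def cross3 (a b : V3) : V3 :=
  vec3 (a 1 * b 2 - a 2 * b 1) (a 2 * b 0 - a 0 * b 2) (a 0 * b 1 - a 1 * b 0)

/-- The Dirichlet support condition: for every `t ∈ [0,T]` the spatial support of the
field is contained in a fixed compact subset of `Ω` (encoding zero Dirichlet BCs). -/
def DirichletBC {α : Type} [Zero α] (Ω : Set V3) (T : ℝ) (F : V3 → ℝ → α) : Prop :=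
  ∃ K : Set V3, IsCompact K ∧ K ⊆ Ω ∧
    ∀ t ∈ Set.Icc (0:ℝ) T, (Function.support fun x => F x t) ⊆ K

/-- Directional derivative of a scalar space-time field along `v`. -/
def dirDeriv (v : V3 × ℝ) (f : V3 × ℝ → ℝ) (p : V3 × ℝ) : ℝ := fderiv ℝ f p v

/-- The `i`-th spatial coordinate direction in space-time. -/
def spaceDir (i : Fin 3) : V3 × ℝ := (EuclideanSpace.single i 1, 0)

/-- The time direction in space-time. -/
def timeDir : V3 × ℝ := (0, 1)

lemma ContDiff.dirDeriv {f : V3 × ℝ → ℝ} {m n : WithTop ℕ∞} (hf : ContDiff ℝ n f)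
    (hmn : m + 1 ≤ n) (v : V3 × ℝ) : ContDiff ℝ m (dirDeriv v f) :=
  (hf.fderiv_right hmn).clm_apply contDiff_const

lemma dirDeriv_comm {f : V3 × ℝ → ℝ} (hf : ContDiff ℝ 2 f) (v w p : V3 × ℝ) :
    dirDeriv v (dirDeriv w f) p = dirDeriv w (dirDeriv v f) p := by
  have hd : Differentiable ℝ (fderiv ℝ f) :=
    (hf.fderiv_right (m := 1) (by norm_num)).differentiable (by norm_num)
  have key : ∀ a b : V3 × ℝ,
      dirDeriv a (dirDeriv b f) p = fderiv ℝ (fderiv ℝ f) p a b := by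
    intro a b
    have h := ((hd p).hasFDerivAt.clm_apply (hasFDerivAt_const b p)).fderiv
    change fderiv ℝ (fun q => fderiv ℝ f q b) p a = _
    rw [h]
    simp
  rw [key, key]
  exact (hf.contDiffAt.isSymmSndFDerivAt (by simp)).eq v w

lemma pd_slice {f : V3 × ℝ → ℝ} (hf : Differentiable ℝ f) (i : Fin 3) (x : V3) (t : ℝ) :
    pd i (fun y => f (y, t)) x = dirDeriv (spaceDir i) f (x, t) := by
  have h := ((hf (x, t)).hasFDerivAt.comp x
    (hasFDerivAt_prodMk_left (𝕜 := ℝ) x t)).fderiv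
  change fderiv ℝ (f ∘ fun y => (y, t)) x _ = _
  rw [h]
  simp [dirDeriv, spaceDir]

lemma hasDerivAt_slice {f : V3 × ℝ → ℝ} (hf : Differentiable ℝ f) (x : V3) (t : ℝ) :
    HasDerivAt (fun s => f (x, s)) (dirDeriv timeDir f (x, t)) t := by
  have h := ((hf (x, t)).hasFDerivAt.comp t (hasFDerivAt_prodMk_right x t)).hasDerivAt
  simpa [dirDeriv, timeDir, Function.comp_def] using h

lemma deriv_euclidean_apply {f : ℝ → V3} {t : ℝ} (hf : DifferentiableAt ℝ f t) (i : Fin 3) :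
    deriv f t i = deriv (fun s => f s i) t :=
  ((EuclideanSpace.proj (𝕜 := ℝ) i).hasFDerivAt.comp_hasDerivAt t hf.hasDerivAt).deriv.symm

lemma deriv_slice_apply {F : V3 × ℝ → V3} (hF : Differentiable ℝ F) (x : V3) (t : ℝ)
    (i : Fin 3) :
    deriv (fun s => F (x, s)) t i = dirDeriv timeDir (fun p => F p i) (x, t) := by
  have hd : DifferentiableAt ℝ (fun s => F (x, s)) t := by fun_prop
  rw [deriv_euclidean_apply hd]
  exact (hasDerivAt_slice (f := fun p => F p i) (by fun_prop) x t).deriv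

lemma dirDeriv_mul_sub_mul {a b c d : V3 × ℝ → ℝ} {p : V3 × ℝ} (ha : DifferentiableAt ℝ a p)
    (hb : DifferentiableAt ℝ b p) (hc : DifferentiableAt ℝ c p) (hd : DifferentiableAt ℝ d p)
    (v : V3 × ℝ) :
    dirDeriv v (fun q => a q * b q - c q * d q) p
      = a p * dirDeriv v b p + b p * dirDeriv v a p
        - (c p * dirDeriv v d p + d p * dirDeriv v c p) := by
  have h := ((ha.hasFDerivAt.mul hb.hasFDerivAt).sub (hc.hasFDerivAt.mul hd.hasFDerivAt)).fderiv
  change fderiv ℝ (a * b - c * d) p v = _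
  rw [h]
  simp [dirDeriv]

lemma dirDeriv_sub {a b : V3 × ℝ → ℝ} {p : V3 × ℝ} (ha : DifferentiableAt ℝ a p)
    (hb : DifferentiableAt ℝ b p) (v : V3 × ℝ) :
    dirDeriv v (fun q => a q - b q) p = dirDeriv v a p - dirDeriv v b p := by
  change fderiv ℝ (a - b) p v = _
  rw [fderiv_sub ha hb]
  rfl

lemma dirDeriv_sum {ι : Type*} [Fintype ι] {a : ι → V3 × ℝ → ℝ} {p : V3 × ℝ}
    (ha : ∀ i, DifferentiableAt ℝ (a i) p) (v : V3 × ℝ) :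
    dirDeriv v (fun q => ∑ i, a i q) p = ∑ i, dirDeriv v (a i) p := by
  simp only [dirDeriv]
  rw [fderiv_fun_sum (fun i _ => ha i)]
  simp

lemma dirDeriv_sum_sq_add {w r : Fin 3 → V3 × ℝ → ℝ} {p : V3 × ℝ} (c : ℝ)
    (hw : ∀ i, DifferentiableAt ℝ (w i) p) (hr : ∀ i, DifferentiableAt ℝ (r i) p)
    (v : V3 × ℝ) :
    dirDeriv v (fun q => ∑ i, w i q ^ 2 + c * ∑ i, r i q ^ 2) p
      = 2 * ∑ i, w i p * dirDeriv v (w i) p + 2 * c * ∑ i, r i p * dirDeriv v (r i) p := by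
  have h := ((HasFDerivAt.fun_sum (u := Finset.univ) fun i _ => (hw i).hasFDerivAt.pow 2).add
    ((HasFDerivAt.fun_sum (u := Finset.univ)
      fun i _ => (hr i).hasFDerivAt.pow 2).const_mul c)).fderiv
  simp only [dirDeriv]
  erw [h]
  simp only [Fin.sum_univ_three, add_apply, smul_apply,
    smul_eq_mul, nsmul_eq_mul]
  norm_num
  ring

lemma Continuous.integrableOn_prod_Ioc {Ω : Set V3} (hΩb : Bornology.IsBounded Ω)
    {f : V3 × ℝ → ℝ} (hf : Continuous f) (a b : ℝ) :
    IntegrableOn f (Ω ×ˢ Set.Ioc a b) (volume.prod volume) :=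
  (hf.continuousOn.integrableOn_compact (hΩb.isCompact_closure.prod isCompact_Icc)).mono_set
    (Set.prod_mono subset_closure Set.Ioc_subset_Icc_self)

lemma Continuous.integrableOn_of_isBounded {Ω : Set V3} (hΩb : Bornology.IsBounded Ω)
    {f : V3 → ℝ} (hf : Continuous f) : IntegrableOn f Ω :=
  (hf.continuousOn.integrableOn_compact hΩb.isCompact_closure).mono_set subset_closure

lemma setIntegral_slice_sub {Ω : Set V3} (hΩb : Bornology.IsBounded Ω) {T : ℝ} (hT : 0 ≤ T)
    {e : V3 × ℝ → ℝ} (he : ContDiff ℝ 1 e) :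
    ∫ t in (0 : ℝ)..T, ∫ x in Ω, dirDeriv timeDir e (x, t)
      = (∫ x in Ω, e (x, T)) - ∫ x in Ω, e (x, 0) := by
  have hc : Continuous (dirDeriv timeDir e) := (he.dirDeriv (m := 0) (by norm_num) _).continuous
  have hec := he.continuous
  rw [intervalIntegral_integral_swap (f := fun t x => dirDeriv timeDir e (x, t)),
    ← integral_sub]
  · congr 1
    ext x
    refine intervalIntegral.integral_eq_sub_of_hasDerivAt
      (fun t _ => hasDerivAt_slice (he.differentiable (by norm_num)) x t) ?_
    exact (hc.comp (by fun_prop : Continuous fun t : ℝ => (x, t))).intervalIntegrable _ _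
  · exact Continuous.integrableOn_of_isBounded hΩb (by fun_prop)
  · exact Continuous.integrableOn_of_isBounded hΩb (by fun_prop)
  · have h := hc.integrableOn_prod_Ioc hΩb 0 T
    rw [IntegrableOn, ← Measure.prod_restrict] at h
    rw [Set.uIoc_of_le hT]
    exact h.swap

lemma integral_pd_eq_zero {g : V3 → ℝ} (hg : ContDiff ℝ 1 g) (hs : HasCompactSupport g)
    (i : Fin 3) : ∫ x, pd i g x = 0 := by
  have hc : Continuous fun x => fderiv ℝ g x (EuclideanSpace.single i 1) :=
    (hg.continuous_fderiv (by norm_num)).clm_apply continuous_const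
  have hcs : HasCompactSupport fun x => fderiv ℝ g x (EuclideanSpace.single i 1) :=
    hs.fderiv_apply ℝ _
  have h := integral_mul_fderiv_eq_neg_fderiv_mul_of_integrable (μ := (volume : Measure V3))
    (f := fun _ => (1 : ℝ)) (g := g) (v := EuclideanSpace.single i 1) (by simp)
    (by simpa using hc.integrable_of_hasCompactSupport hcs)
    (by simpa using hg.continuous.integrable_of_hasCompactSupport hs)
    (fun _ _ => by fun_prop) (fun x _ => hg.differentiable (by norm_num) x)
  simpa [pd] using h

lemma setIntegral_dirDeriv_spaceDir_eq_zero {Ω K : Set V3} (hK : IsCompact K) (hKΩ : K ⊆ Ω)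
    {g : V3 × ℝ → ℝ} (hg : ContDiff ℝ 1 g) {t : ℝ} (hs : ∀ x ∉ K, g (x, t) = 0) (i : Fin 3) :
    ∫ x in Ω, dirDeriv (spaceDir i) g (x, t) = 0 := by
  have hslice : ContDiff ℝ 1 fun y => g (y, t) := by fun_prop
  have hcs : HasCompactSupport fun y => g (y, t) := HasCompactSupport.intro hK hs
  have hsub : tsupport (fun y => g (y, t)) ⊆ K :=
    closure_minimal (fun x hx => by_contra fun hxK => hx (hs x hxK)) hK.isClosed
  simp_rw [← pd_slice (hg.differentiable (by norm_num))]
  rw [setIntegral_eq_integral_of_forall_compl_eq_zero, integral_pd_eq_zero hslice hcs]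
  intro x hx
  have : x ∉ tsupport (fderiv ℝ fun y => g (y, t)) := fun h =>
    hx (hKΩ (hsub (tsupport_fderiv_subset ℝ h)))
  simp [pd, image_eq_zero_of_notMem_tsupport this]

/-- Components of the spatial curl, with cyclic indices. -/
def curlComp (u : Fin 3 → V3 × ℝ → ℝ) (k : Fin 3) (p : V3 × ℝ) : ℝ :=
  dirDeriv (spaceDir (k + 1)) (u (k + 2)) p - dirDeriv (spaceDir (k + 2)) (u (k + 1)) p

/-- Components of `∂ₜu × curl u`, with cyclic indices. -/
def fluxComp (u : Fin 3 → V3 × ℝ → ℝ) (k : Fin 3) (p : V3 × ℝ) : ℝ :=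
  dirDeriv timeDir (u (k + 1)) p * curlComp u (k + 2) p
    - dirDeriv timeDir (u (k + 2)) p * curlComp u (k + 1) p

/-- Pointwise energy density `|∂ₜu|² + c |curl u|²`. -/
def energyDensity (c : ℝ) (u : Fin 3 → V3 × ℝ → ℝ) (p : V3 × ℝ) : ℝ :=
  ∑ i, dirDeriv timeDir (u i) p ^ 2 + c * ∑ i, curlComp u i p ^ 2

section

variable {u : Fin 3 → V3 × ℝ → ℝ}

lemma contDiff_curlComp (hu : ∀ i, ContDiff ℝ 2 (u i)) (k : Fin 3) :
    ContDiff ℝ 1 (curlComp u k) :=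
  ((hu _).dirDeriv (by norm_num) _).sub ((hu _).dirDeriv (by norm_num) _)

lemma contDiff_fluxComp (hu : ∀ i, ContDiff ℝ 2 (u i)) (k : Fin 3) :
    ContDiff ℝ 1 (fluxComp u k) :=
  (((hu _).dirDeriv (by norm_num) _).mul (contDiff_curlComp hu _)).sub
    (((hu _).dirDeriv (by norm_num) _).mul (contDiff_curlComp hu _))

lemma contDiff_energyDensity (c : ℝ) (hu : ∀ i, ContDiff ℝ 2 (u i)) :
    ContDiff ℝ 1 (energyDensity c u) :=
  (ContDiff.sum fun i _ => ((hu i).dirDeriv (by norm_num) _).pow 2).add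
    (contDiff_const.mul (ContDiff.sum fun i _ => (contDiff_curlComp hu i).pow 2))

lemma dirDeriv_curlComp (hu : ∀ i, ContDiff ℝ 2 (u i)) (k : Fin 3) (v p : V3 × ℝ) :
    dirDeriv v (curlComp u k) p
      = dirDeriv v (dirDeriv (spaceDir (k + 1)) (u (k + 2))) p
        - dirDeriv v (dirDeriv (spaceDir (k + 2)) (u (k + 1))) p :=
  dirDeriv_sub (((hu _).dirDeriv (m := 1) (by norm_num) _).differentiable (by norm_num) _)
    (((hu _).dirDeriv (m := 1) (by norm_num) _).differentiable (by norm_num) _) v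

/-- Local energy balance for the wave equation, in the form obtained from
`curl curl = grad div - Δ` and `div (a × b) = b · curl a - a · curl b`. -/
lemma dirDeriv_timeDir_energyDensity (c : ℝ) (hu : ∀ i, ContDiff ℝ 2 (u i)) (p : V3 × ℝ)
    (hwave : ∀ i, dirDeriv timeDir (dirDeriv timeDir (u i)) p
      = c * ∑ j, dirDeriv (spaceDir j) (dirDeriv (spaceDir j) (u i)) p) :
    dirDeriv timeDir (energyDensity c u) p
      = 2 * c * ∑ i, dirDeriv timeDir (u i) p
            * ∑ j, dirDeriv (spaceDir i) (dirDeriv (spaceDir j) (u j)) p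
        + 2 * c * ∑ k, dirDeriv (spaceDir k) (fluxComp u k) p := by
  have hD : ∀ i v, DifferentiableAt ℝ (dirDeriv v (u i)) p := fun i v =>
    ((hu i).dirDeriv (m := 1) (by norm_num) v).differentiable (by norm_num) p
  have hC : ∀ k, DifferentiableAt ℝ (curlComp u k) p := fun k =>
    (contDiff_curlComp hu k).differentiable (by norm_num) p
  have hflux : ∀ k v, dirDeriv v (fluxComp u k) p = _ := fun k v =>
    dirDeriv_mul_sub_mul (hD (k + 1) timeDir) (hC (k + 2)) (hD (k + 2) timeDir) (hC (k + 1)) v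
  have henergy : dirDeriv timeDir (energyDensity c u) p = _ :=
    dirDeriv_sum_sq_add c (fun i => hD i timeDir) hC timeDir
  rw [henergy]
  simp only [hwave, hflux, dirDeriv_curlComp hu]
  simp only [fun v i => dirDeriv_comm (hu i) v timeDir p]
  have e1 : (1 : Fin 3) + 1 = 2 := rfl
  have e2 : (1 : Fin 3) + 2 = 0 := rfl
  have e3 : (2 : Fin 3) + 1 = 0 := rfl
  have e4 : (2 : Fin 3) + 2 = 1 := rfl
  simp only [Fin.sum_univ_three, curlComp, zero_add, e1, e2, e3, e4]
  simp only [fun i => dirDeriv_comm (hu i) (spaceDir 1) (spaceDir 0) p,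
    fun i => dirDeriv_comm (hu i) (spaceDir 2) (spaceDir 0) p,
    fun i => dirDeriv_comm (hu i) (spaceDir 2) (spaceDir 1) p]
  ring

end

lemma dirDeriv_eq_zero_of_eqOn {K : Set V3} (hK : IsClosed K) {T : ℝ} (hT : 0 < T)
    {f : V3 × ℝ → ℝ} (hf : ContDiff ℝ 1 f)
    (hs : ∀ x ∉ K, ∀ t ∈ Set.Icc (0 : ℝ) T, f (x, t) = 0)
    {x : V3} (hx : x ∉ K) {t : ℝ} (ht : t ∈ Set.Icc (0 : ℝ) T) (v : V3 × ℝ) :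
    dirDeriv v f (x, t) = 0 := by
  have hc : Continuous (dirDeriv v f) := (hf.dirDeriv (m := 0) (by norm_num) _).continuous
  have hopen : IsOpen (Kᶜ ×ˢ Set.Ioo (0 : ℝ) T) := hK.isOpen_compl.prod isOpen_Ioo
  have hzero : Set.EqOn (dirDeriv v f) 0 (Kᶜ ×ˢ Set.Ioo (0 : ℝ) T) := by
    intro q hq
    have : f =ᶠ[nhds q] fun _ => 0 := by
      filter_upwards [hopen.mem_nhds hq] with y hy
      exact hs y.1 hy.1 y.2 (Set.Ioo_subset_Icc_self hy.2)
    simp [dirDeriv, this.fderiv_eq]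
  refine hzero.closure hc continuous_const ?_
  rw [closure_prod_eq, closure_Ioo hT.ne]
  exact ⟨subset_closure hx, ht⟩

theorem polarization_wave_energy_identity (Ω : Set V3) (hΩo : IsOpen Ω) (hΩb : Bornology.IsBounded Ω)
    (T : ℝ) (hT : 0 < T)
    (vg : ℝ) (hvg : 0 < vg) (P : V3 → ℝ → V3) (Ne : V3 → ℝ → ℝ)
    (hP : ContDiff ℝ 2 (fun p : V3 × ℝ => P p.1 p.2))
    (hNe : ContDiff ℝ 1 (fun p : V3 × ℝ => Ne p.1 p.2))
    (hwave : ∀ x : V3, ∀ t ∈ Set.Icc (0:ℝ) T,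
      deriv (deriv (P x)) t = vg^2 • veclap (fun y => P y t) x)
    (hPbc : DirichletBC Ω T P)
    (hgrad : ∀ x : V3, ∀ t ∈ Set.Icc (0:ℝ) T,
      sgrad (fun y => Ne y t) x = sgrad (fun y => sdiv (fun z => P z t) y) x) :
    (∫ x in Ω, ‖deriv (P x) T‖^2) + vg^2 * (∫ x in Ω, ‖scurl (fun y => P y T) x‖^2)
      = (∫ x in Ω, ‖deriv (P x) 0‖^2) + vg^2 * (∫ x in Ω, ‖scurl (fun y => P y 0) x‖^2)
        + 2*vg^2 * (∫ t in (0:ℝ)..T, ∫ x in Ω,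
            ⟪deriv (P x) t, sgrad (fun y => Ne y t) x⟫) := by
  obtain ⟨K, hK, hKΩ, hsupp⟩ := hPbc
  set u : Fin 3 → V3 × ℝ → ℝ := fun i p => P p.1 p.2 i with hu_def
  have hu : ∀ i, ContDiff ℝ 2 (u i) := fun i => contDiff_euclidean.1 hP i
  have hud : ∀ i, Differentiable ℝ (u i) := fun i => (hu i).differentiable (by norm_num)
  have hD1 : ∀ i v, ContDiff ℝ 1 (dirDeriv v (u i)) := fun i v =>
    (hu i).dirDeriv (by norm_num) v
  have hDd : ∀ i v, Differentiable ℝ (dirDeriv v (u i)) := fun i v =>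
    (hD1 i v).differentiable (by norm_num)
  have hdt : ∀ x t i, deriv (P x) t i = dirDeriv timeDir (u i) (x, t) := fun x t i =>
    deriv_slice_apply (F := fun p => P p.1 p.2) (hP.differentiable (by norm_num)) x t i
  have hdtt : ∀ x t i,
      deriv (deriv (P x)) t i = dirDeriv timeDir (dirDeriv timeDir (u i)) (x, t) := by
    intro x t i
    have hd : DifferentiableAt ℝ (deriv (P x)) t := differentiableAt_euclidean.2 fun j => by
      simp only [hdt]
      exact (hasDerivAt_slice (hDd j timeDir) x t).differentiableAt
    rw [deriv_euclidean_apply hd]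
    simp only [hdt]
    exact (hasDerivAt_slice (hDd i timeDir) x t).deriv
  have hpd : ∀ i j x t, pd j (fun y => P y t i) x = dirDeriv (spaceDir j) (u i) (x, t) :=
    fun i j x t => pd_slice (hud i) j x t
  have hpd2 : ∀ i j k x t, pd k (fun y => dirDeriv (spaceDir j) (u i) (y, t)) x
      = dirDeriv (spaceDir k) (dirDeriv (spaceDir j) (u i)) (x, t) :=
    fun i j k x t => pd_slice (hDd i _) k x t
  have hwave' : ∀ x, ∀ t ∈ Set.Icc (0 : ℝ) T, ∀ i,
      dirDeriv timeDir (dirDeriv timeDir (u i)) (x, t)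
        = vg ^ 2 * ∑ j, dirDeriv (spaceDir j) (dirDeriv (spaceDir j) (u i)) (x, t) := by
    intro x t ht i
    rw [← hdtt, hwave x t ht]
    simp [veclap, slap, hpd, hpd2]
  have hgrad' : ∀ x, ∀ t ∈ Set.Icc (0 : ℝ) T, ∀ i, sgrad (fun y => Ne y t) x i
      = ∑ j, dirDeriv (spaceDir i) (dirDeriv (spaceDir j) (u j)) (x, t) := by
    intro x t ht i
    rw [hgrad x t ht, ← dirDeriv_sum (fun j => hDd j (spaceDir j) (x, t)),
      ← pd_slice (f := fun q => ∑ j, dirDeriv (spaceDir j) (u j) q)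
        (Differentiable.fun_sum fun j _ => hDd j (spaceDir j))]
    simp [sgrad, sdiv, hpd]
  have hcurl : ∀ x t, ‖scurl (fun y => P y t) x‖ ^ 2 = ∑ i, curlComp u i (x, t) ^ 2 := by
    intro x t
    have e1 : (1 : Fin 3) + 1 = 2 := rfl
    have e2 : (1 : Fin 3) + 2 = 0 := rfl
    have e3 : (2 : Fin 3) + 1 = 0 := rfl
    have e4 : (2 : Fin 3) + 2 = 1 := rfl
    simp [EuclideanSpace.real_norm_sq_eq, Fin.sum_univ_three, scurl, vec3, curlComp, hpd,
      e1, e2, e3, e4]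
  have hkin : ∀ x t, ‖deriv (P x) t‖ ^ 2 = ∑ i, dirDeriv timeDir (u i) (x, t) ^ 2 := by
    intro x t
    simp [EuclideanSpace.real_norm_sq_eq, hdt]
  have henergy : ∀ t, (∫ x in Ω, energyDensity (vg ^ 2) u (x, t))
      = (∫ x in Ω, ‖deriv (P x) t‖ ^ 2)
        + vg ^ 2 * ∫ x in Ω, ‖scurl (fun y => P y t) x‖ ^ 2 := by
    intro t
    simp only [hkin, hcurl, energyDensity]
    rw [integral_add, integral_const_mul]
    · refine Continuous.integrableOn_of_isBounded hΩb ?_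
      have := fun i => (hD1 i timeDir).continuous
      fun_prop
    · refine Continuous.integrableOn_of_isBounded hΩb ?_
      have := fun i => (contDiff_curlComp hu i).continuous
      fun_prop
  have hflux : ∀ t ∈ Set.Icc (0 : ℝ) T, ∀ k,
      ∫ x in Ω, dirDeriv (spaceDir k) (fluxComp u k) (x, t) = 0 := by
    intro t ht k
    refine setIntegral_dirDeriv_spaceDir_eq_zero hK hKΩ (contDiff_fluxComp hu k) (fun x hx => ?_) k
    have hz : ∀ i, dirDeriv timeDir (u i) (x, t) = 0 := fun i =>
      dirDeriv_eq_zero_of_eqOn hK.isClosed hT ((hu i).of_le (by norm_num))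
        (fun y hy s hs => by
          have : P y s = 0 := by_contra fun h => hy (hsupp s hs h)
          simp [hu_def, this]) hx ht timeDir
    simp [fluxComp, hz]
  have hbalance : ∀ t ∈ Set.Icc (0 : ℝ) T,
      (∫ x in Ω, dirDeriv timeDir (energyDensity (vg ^ 2) u) (x, t))
        = 2 * vg ^ 2 * ∫ x in Ω, ⟪deriv (P x) t, sgrad (fun y => Ne y t) x⟫ := by
    intro t ht
    have hcont : ∀ k, Continuous (dirDeriv (spaceDir k) (fluxComp u k)) := fun k =>
      ((contDiff_fluxComp hu k).dirDeriv (m := 0) (by norm_num) _).continuous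
    have hcont2 : ∀ i v w, Continuous (dirDeriv v (dirDeriv w (u i))) := fun i v w =>
      ((hD1 i w).dirDeriv (m := 0) (by norm_num) _).continuous
    have hcont1 := fun i => (hD1 i timeDir).continuous
    have hinner : ∀ x, ⟪deriv (P x) t, sgrad (fun y => Ne y t) x⟫
        = ∑ i, dirDeriv timeDir (u i) (x, t)
            * ∑ j, dirDeriv (spaceDir i) (dirDeriv (spaceDir j) (u j)) (x, t) := by
      intro x
      simp [PiLp.inner_apply, hdt, hgrad' x t ht, mul_comm]
    have hzero : ∫ x in Ω, ∑ k, dirDeriv (spaceDir k) (fluxComp u k) (x, t) = 0 := by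
      rw [integral_finsetSum]
      · exact Finset.sum_eq_zero fun k _ => hflux t ht k
      · exact fun k _ => Continuous.integrableOn_of_isBounded hΩb (by fun_prop)
    simp only [hinner,
      fun x => dirDeriv_timeDir_energyDensity (vg ^ 2) hu (x, t) (hwave' x t ht)]
    rw [integral_add, integral_const_mul, integral_const_mul, hzero, mul_zero, add_zero]
    · exact Continuous.integrableOn_of_isBounded hΩb (by fun_prop)
    · exact Continuous.integrableOn_of_isBounded hΩb (by fun_prop)
  have hmain := setIntegral_slice_sub hΩb hT.le (contDiff_energyDensity (vg ^ 2) hu)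
  rw [henergy, henergy, intervalIntegral.integral_congr (g := fun t =>
      2 * vg ^ 2 * ∫ x in Ω, ⟪deriv (P x) t, sgrad (fun y => Ne y t) x⟫)
      (fun t ht => hbalance t (by rwa [Set.uIcc_of_le hT.le] at ht)),
    intervalIntegral.integral_const_mul] at hmain
  linarith
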